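/- Assume that for every b ∈ {1,…,n}, every nonzero integer d' and every v ∈ V, the evaluation of the word x_b^{d'} at v is never defined and equal to v (the graph contains no loop representing any x_b^{d'}). Then there exist a finite set W containing V and, for each generator ℓ ∈ L, a bijection g_ℓ : W → W whose restriction to the domain of f_ℓ agrees with f_ℓ, such that: (a) the group of permutations of W generated by the g_ℓ acts transitively on W; (b) for every b ∈ {1,…,n} and every integer 1 ≤ e ≤ |W| − 1, the permutation of W obtained by evaluating the word x_b in the bijections g_ℓ has no fixed point when raised to the e-th power (equivalently, each x_b acts on W as a single |W|-cycle). In particular, if the evaluation at a vertex v₀ ∈ V of some word y (in the generators and their inverses) is defined in V and different from v₀, then its evaluation via the g_ℓ is still different from v₀. -/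

import Mathlib

/-- The letter set `L = {a_1,b_1,…,a_g,b_g,x_1,…,x_{n-1}}`. -/
abbrev Letter (g n : ℕ) := Sum (Fin g) (Sum (Fin g) (Fin (n - 1)))

/-- A word in the letters of `L` and their inverses (`true` = the letter,
`false` = its inverse). -/
abbrev LWord (g n : ℕ) := List (Letter g n × Bool)

/-- The boundary words `x_1,…,x_n` as words in `L ∪ L⁻¹`, where
`x_n = [a_1,b_1]⋯[a_g,b_g]·x_1⋯x_{n-1}`. -/
def xWord (g n : ℕ) (b : Fin n) : LWord g n :=
  if h : (b : ℕ) < n - 1 then [(Sum.inr (Sum.inr ⟨(b : ℕ), h⟩), true)]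
  else
    (List.ofFn fun i : Fin g =>
      [((Sum.inl i : Letter g n), true), (Sum.inr (Sum.inl i), true),
        (Sum.inl i, false), (Sum.inr (Sum.inl i), false)]).flatten ++
      List.ofFn fun i : Fin (n - 1) => ((Sum.inr (Sum.inr i) : Letter g n), true)

/-- The formal inverse of a word. -/
def wordInv {g n : ℕ} (w : LWord g n) : LWord g n :=
  w.reverse.map fun p => (p.1, !p.2)

/-- The `k`-th power of a word, `k ∈ ℤ`. -/
def wordZPow {g n : ℕ} (w : LWord g n) (k : ℤ) : LWord g n :=
  if 0 ≤ k then (List.replicate k.toNat w).flatten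
  else wordInv (List.replicate (-k).toNat w).flatten

/-- The relation on vertices determined by a single (signed) letter, given the
partial maps `R ℓ` (`R ℓ v u` meaning the `ℓ`-labeled edge maps `v` to `u`). -/
def letterRel {g n : ℕ} {V : Type*} (R : Letter g n → V → V → Prop) :
    Letter g n × Bool → V → V → Prop
  | (ℓ, true) => R ℓ
  | (ℓ, false) => fun v u => R ℓ u v

/-- `wordRel R w v u` : the evaluation of the word `w` at `v` is defined and
equals `u`. -/
def wordRel {g n : ℕ} {V : Type*} (R : Letter g n → V → V → Prop) :
    LWord g n → V → V → Prop
  | [] => fun v u => v = u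
  | p :: rest => fun v u => ∃ v', letterRel R p v v' ∧ wordRel R rest v' u

/-- Evaluation of a word when each letter acts by a genuine permutation
(letters are applied from left to right). -/
def permEval {g n : ℕ} {W : Type*} (gp : Letter g n → Equiv.Perm W)
    (w : LWord g n) : Equiv.Perm W :=
  ((w.map fun p => cond p.2 (gp p.1) (gp p.1)⁻¹).reverse).prod

open Equiv Equiv.Perm

section Merge

variable {W : Type*} [Finite W]

theorem sameCycle_coarsen {f h : Perm W} (hstep : ∀ w, SameCycle h w (f w)) {u w : W}
    (huw : SameCycle f u w) : SameCycle h u w := by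
  obtain ⟨i, -, rfl⟩ := huw.exists_pow_eq'
  clear huw
  induction i with
  | zero => simp [SameCycle.refl]
  | succ i ih =>
    rw [pow_succ', Perm.mul_apply]
    exact ih.trans (hstep _)

variable [DecidableEq W]

theorem sameCycle_mul_swap_left {f : Perm W} {x y : W} (hxy : ¬ SameCycle f x y) {w : W}
    (hw : SameCycle f y w) : SameCycle (f * swap x y) x w := by
  have hg : (f * swap x y) x = f y := by simp
  have key : ∀ i : ℕ, SameCycle (f * swap x y) x ((f ^ (i + 1)) y) := by
    intro i
    induction i with
    | zero => exact ⟨1, by simp⟩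
    | succ i ih =>
      rw [pow_succ', Perm.mul_apply]
      by_cases hy : (f ^ (i + 1)) y = y
      · rw [hy]; exact ⟨1, by simp⟩
      · have hx : (f ^ (i + 1)) y ≠ x := fun h =>
          hxy (SameCycle.symm ⟨((i + 1 : ℕ) : ℤ), by rw [zpow_natCast]; exact h⟩)
        refine ih.trans ⟨1, ?_⟩
        simp [swap_apply_of_ne_of_ne hx hy]
  obtain ⟨i, hi, -, rfl⟩ := hw.exists_pow_eq''
  obtain ⟨j, rfl⟩ : ∃ j, i = j + 1 := ⟨i - 1, by omega⟩
  exact key j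

theorem sameCycle_mul_swap_self {f : Perm W} {x y : W} (hxy : ¬ SameCycle f x y) :
    SameCycle (f * swap x y) x y :=
  sameCycle_mul_swap_left hxy (SameCycle.refl _ _)

theorem sameCycle_mul_swap_of_sameCycle {f : Perm W} {x y : W} (hxy : ¬ SameCycle f x y) {u w : W}
    (huw : SameCycle f u w) : SameCycle (f * swap x y) u w := by
  have hself := sameCycle_mul_swap_self hxy
  refine sameCycle_coarsen (fun v => ?_) huw
  by_cases hx : v = x
  · subst hx
    exact hself.trans ⟨1, by simp⟩
  by_cases hy : v = y
  · subst hy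
    exact hself.symm.trans ⟨1, by simp⟩
  exact ⟨1, by simp [swap_apply_of_ne_of_ne hx hy]⟩

theorem sameCycle_of_sameCycle_mul_swap {f : Perm W} {x y s : W} (hx : ¬ SameCycle f x s)
    (hy : ¬ SameCycle f y s) {w : W} (hw : SameCycle (f * swap x y) s w) : SameCycle f s w := by
  obtain ⟨i, -, rfl⟩ := hw.exists_pow_eq'
  clear hw
  induction i with
  | zero => simp [SameCycle.refl]
  | succ i ih =>
    rw [pow_succ', Perm.mul_apply, Perm.mul_apply, swap_apply_of_ne_of_ne]
    · exact ih.trans ⟨1, by simp⟩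
    · intro h; exact hx (h ▸ ih.symm)
    · intro h; exact hy (h ▸ ih.symm)

theorem not_sameCycle_mul_swap {f : Perm W} {x y : W} (hne : x ≠ y) (hxy : SameCycle f x y) :
    ¬ SameCycle (f * swap x y) x y := by
  classical
  have hex : ∃ i, 0 < i ∧ (f ^ i) x = y := by
    obtain ⟨i, hi, -, h⟩ := hxy.exists_pow_eq''
    exact ⟨i, hi, h⟩
  obtain ⟨hi0, hi⟩ := Nat.find_spec hex
  have hmin : ∀ j, 0 < j → j < Nat.find hex → (f ^ j) x ≠ y := fun j hj hlt h =>
    Nat.find_min hex hlt ⟨hj, h⟩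
  set i := Nat.find hex
  have hminx : ∀ j, 0 < j → j < i → (f ^ j) x ≠ x := by
    intro j hj hlt h
    refine hmin (i - j) (by omega) (by omega) ?_
    rw [← hi, show i = (i - j) + j by omega, pow_add, Perm.mul_apply, h]
    congr 2; simp
  have key : ∀ j, 0 < j → j ≤ i → ((f * swap x y) ^ j) y = (f ^ j) x := by
    intro j hj
    induction j, hj using Nat.le_induction with
    | base => intro _; simp
    | succ j hj ih =>
      intro hle
      rw [pow_succ', Perm.mul_apply, ih (by omega), Perm.mul_apply,
        swap_apply_of_ne_of_ne (hminx j hj (by omega)) (hmin j hj (by omega)), pow_succ',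
        Perm.mul_apply]
  intro hcon
  have hper : Function.IsPeriodicPt (f * swap x y) i y := by
    rw [Function.IsPeriodicPt, Function.IsFixedPt, iterate_eq_pow, key i hi0 le_rfl, hi]
  obtain ⟨k, -, hk⟩ := hcon.symm.exists_pow_eq'
  rw [← iterate_eq_pow, ← hper.iterate_mod_apply k, iterate_eq_pow] at hk
  have hlt := Nat.mod_lt k hi0
  rcases Nat.eq_zero_or_pos (k % i) with h0 | h0
  · rw [h0] at hk; exact hne (by simpa using hk.symm)
  · rw [key _ h0 hlt.le] at hk
    exact hminx _ h0 hlt hk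

theorem sameCycle_mul_swap_or {f : Perm W} {x y w : W} (hw : SameCycle f x w) :
    SameCycle (f * swap x y) x w ∨ SameCycle (f * swap x y) y w := by
  obtain ⟨i, -, rfl⟩ := hw.exists_pow_eq'
  clear hw
  induction i with
  | zero => simp [SameCycle.refl]
  | succ i ih =>
    rw [pow_succ', Perm.mul_apply]
    generalize (f ^ i) x = v at ih
    by_cases hx : v = x
    · subst hx
      exact Or.inr ⟨1, by simp⟩
    by_cases hy : v = y
    · subst hy
      exact Or.inl ⟨1, by simp⟩
    have hv : SameCycle (f * swap x y) v (f v) := ⟨1, by simp [swap_apply_of_ne_of_ne hx hy]⟩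
    exact ih.imp (·.trans hv) (·.trans hv)

end Merge

section Transitive

/-- Every two points lie in the same cycle. -/
def IsFullCycle {W : Type*} (f : Perm W) : Prop := ∀ u w, SameCycle f u w

variable {W : Type*}

theorem IsFullCycle.isCycleOn {f : Perm W} (hf : IsFullCycle f) : f.IsCycleOn Set.univ :=
  ⟨by simp [Set.bijOn_univ, f.bijective], fun u _ w _ => hf u w⟩

theorem IsFullCycle.conj {f : Perm W} (hf : IsFullCycle f) (h : Perm W) :
    IsFullCycle (h * f * h⁻¹) := fun u w => by
  rw [sameCycle_conj]; exact hf _ _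

theorem IsFullCycle.pow_apply_ne [Fintype W] {f : Perm W} (hf : IsFullCycle f) {e : ℕ}
    (h1 : 1 ≤ e) (he : e ≤ Fintype.card W - 1) (w : W) : (f ^ e) w ≠ w := by
  intro h
  have := ((Finset.coe_univ (α := W) ▸ hf.isCycleOn :
    f.IsCycleOn ((Finset.univ : Finset W) : Set W)).pow_apply_eq (Finset.mem_univ w)).1 h
  have := Nat.le_of_dvd h1 this
  rw [Finset.card_univ] at this
  omega

theorem IsFullCycle.sign_eq_one [Fintype W] [DecidableEq W] {f : Perm W} (hf : IsFullCycle f)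
    (hodd : Odd (Fintype.card W)) : sign f = 1 := by
  have hpow : f ^ Fintype.card W = 1 := by
    ext w
    have := ((Finset.coe_univ (α := W) ▸ hf.isCycleOn :
      f.IsCycleOn ((Finset.univ : Finset W) : Set W)).pow_apply_eq (Finset.mem_univ w)
        (n := Fintype.card W)).2 (by rw [Finset.card_univ])
    simpa using this
  have := congrArg sign hpow
  rw [map_pow, map_one] at this
  rcases Int.units_eq_one_or (sign f) with h | h
  · exact h
  · rw [h, hodd.neg_one_pow] at this
    exact absurd this (by decide)

variable [Finite W]

/-- Multiplying by a permutation supported on a set meeting every cycle, one can join all the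
cycles of a permutation. -/
theorem exists_isFullCycle_mul (f : Perm W) (S : Set W)
    (hS : ∀ w, ∃ s ∈ S, SameCycle f w s) :
    ∃ ρ : Perm W, (∀ w, w ∉ S → ρ w = w) ∧ IsFullCycle (f * ρ) := by
  classical
  rcases isEmpty_or_nonempty W with hW | ⟨⟨w₀⟩⟩
  · exact ⟨1, fun _ _ => rfl, fun u => hW.elim u⟩
  obtain ⟨s₀, hs₀, -⟩ := hS w₀
  obtain ⟨ρ, ⟨hρ, hρS⟩, hmax⟩ := Set.exists_max_image
    {ρ : Perm W | (∀ w, w ∉ S → ρ w = w) ∧ ∀ w, ∃ s ∈ S, SameCycle (f * ρ) w s}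
    (fun ρ => {w | SameCycle (f * ρ) s₀ w}.ncard) (Set.toFinite _)
    ⟨1, fun _ _ => rfl, by simpa using hS⟩
  refine ⟨ρ, hρ, ?_⟩
  suffices h : ∀ w, SameCycle (f * ρ) s₀ w from fun u w => (h u).symm.trans (h w)
  by_contra! hcon
  obtain ⟨w, hw⟩ := hcon
  obtain ⟨s₁, hs₁, hws₁⟩ := hρS w
  have hne : ¬ SameCycle (f * ρ) s₀ s₁ := fun h => hw (h.trans hws₁.symm)
  have hle := hmax (ρ * swap s₀ s₁) ⟨fun v hv => by
    rw [Perm.mul_apply, swap_apply_of_ne_of_ne, hρ v hv] <;> rintro rfl <;> contradiction,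
    fun v => by
      obtain ⟨s, hs, hvs⟩ := hρS v
      exact ⟨s, hs, by rw [← mul_assoc]; exact sameCycle_mul_swap_of_sameCycle hne hvs⟩⟩
  refine absurd hle (not_le.2 (Set.ncard_lt_ncard ⟨fun v hv => ?_, fun hsub => hne ?_⟩))
  · change SameCycle (f * (ρ * swap s₀ s₁)) s₀ v
    rw [← mul_assoc]; exact sameCycle_mul_swap_of_sameCycle hne hv
  · refine hsub (?_ : SameCycle (f * (ρ * swap s₀ s₁)) s₀ s₁)
    rw [← mul_assoc]; exact sameCycle_mul_swap_self hne

/-- If `S` lies in one cycle of `α` and meets every cycle of the even permutation `β` of an odd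
number of points, then multiplying by a permutation supported on `S` can turn `β` into a full
cycle while keeping `S` in one cycle of `α`. -/
theorem exists_isFullCycle_mul_of_sign {W : Type*} [Fintype W] [DecidableEq W]
    (α β : Perm W) (S : Set W)
    (hα : ∀ s ∈ S, ∀ t ∈ S, SameCycle α s t) (hβ : ∀ w, ∃ s ∈ S, SameCycle β w s)
    (hodd : Odd (Fintype.card W)) (hsign : sign β = 1) :
    ∃ ρ : Perm W, (∀ w, w ∉ S → ρ w = w) ∧ (∀ s ∈ S, ∀ t ∈ S, SameCycle (α * ρ) s t) ∧
      IsFullCycle (β * ρ) := by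
  classical
  rcases isEmpty_or_nonempty W with hW | ⟨⟨w₀⟩⟩
  · exact ⟨1, fun _ _ => rfl, fun s => hW.elim s, fun u => hW.elim u⟩
  obtain ⟨s₀, hs₀, -⟩ := hβ w₀
  obtain ⟨ρ, ⟨hρ, hρα, hρβ, hρsign⟩, hmax⟩ := Set.exists_max_image
    {ρ : Perm W | (∀ w, w ∉ S → ρ w = w) ∧ (∀ s ∈ S, ∀ t ∈ S, SameCycle (α * ρ) s t) ∧
      (∀ w, ∃ s ∈ S, SameCycle (β * ρ) w s) ∧ sign ρ = 1}
    (fun ρ => {w | SameCycle (β * ρ) s₀ w}.ncard) (Set.toFinite _)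
    ⟨1, fun _ _ => rfl, by simpa using hα, by simpa using hβ, by simp⟩
  refine ⟨ρ, hρ, hρα, ?_⟩
  suffices h : ∀ w, SameCycle (β * ρ) s₀ w from fun u w => (h u).symm.trans (h w)
  by_contra! hcon
  obtain ⟨w, hw⟩ := hcon
  obtain ⟨s₁, hs₁, hws₁⟩ := hρβ w
  have h01 : ¬ SameCycle (β * ρ) s₀ s₁ := fun h => hw (h.trans hws₁.symm)
  obtain ⟨v, hv0, hv1⟩ : ∃ v, ¬ SameCycle (β * ρ) s₀ v ∧ ¬ SameCycle (β * ρ) s₁ v := by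
    by_contra! hall
    have hself := sameCycle_mul_swap_self h01
    have hfull : IsFullCycle (β * ρ * swap s₀ s₁) := by
      suffices h : ∀ u, SameCycle (β * ρ * swap s₀ s₁) s₀ u from
        fun u w => (h u).symm.trans (h w)
      intro u
      by_cases hu : SameCycle (β * ρ) s₀ u
      · exact sameCycle_mul_swap_of_sameCycle h01 hu
      · exact hself.trans (sameCycle_mul_swap_of_sameCycle h01 (hall u hu))
    have hs := hfull.sign_eq_one hodd
    have hne : s₀ ≠ s₁ := fun h => h01 (h ▸ SameCycle.refl _ _)
    rw [Perm.sign_mul, Perm.sign_mul, hsign, hρsign, sign_swap hne] at hs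
    exact absurd hs (by decide)
  obtain ⟨s₂, hs₂, hvs₂⟩ := hρβ v
  have h02 : ¬ SameCycle (β * ρ) s₀ s₂ := fun h => hv0 (h.trans hvs₂.symm)
  have h12 : ¬ SameCycle (β * ρ) s₁ s₂ := fun h => hv1 (h.trans hvs₂.symm)
  have hne01 : s₀ ≠ s₁ := fun h => h01 (h ▸ SameCycle.refl _ _)
  have hαsplit := not_sameCycle_mul_swap hne01 (hρα s₀ hs₀ s₁ hs₁)
  obtain ⟨s, hs, hs01, hαs⟩ : ∃ s ∈ S, (s = s₀ ∨ s = s₁) ∧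
      ¬ SameCycle (α * ρ * swap s₀ s₁) s s₂ := by
    by_cases h : SameCycle (α * ρ * swap s₀ s₁) s₀ s₂
    · exact ⟨s₁, hs₁, Or.inr rfl, fun h' => hαsplit (h.trans h'.symm)⟩
    · exact ⟨s₀, hs₀, Or.inl rfl, h⟩
  have hβs : ¬ SameCycle (β * ρ * swap s₀ s₁) s s₂ := by
    intro h
    have := sameCycle_of_sameCycle_mul_swap h02 h12 h.symm
    rcases hs01 with rfl | rfl
    · exact h02 this.symm
    · exact h12 this.symm
  have hnes : s ≠ s₂ := fun h => hβs (h ▸ SameCycle.refl _ _)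
  have hmono : ∀ {u w}, SameCycle (β * ρ) u w →
      SameCycle (β * ρ * swap s₀ s₁ * swap s s₂) u w := fun h =>
    sameCycle_mul_swap_of_sameCycle hβs (sameCycle_mul_swap_of_sameCycle h01 h)
  have hαS : ∀ t ∈ S, SameCycle (α * ρ * swap s₀ s₁ * swap s s₂) s₂ t := by
    have hself := sameCycle_mul_swap_self hαs
    have hcover : ∀ t ∈ S, SameCycle (α * ρ * swap s₀ s₁) s₀ t ∨
      SameCycle (α * ρ * swap s₀ s₁) s₁ t := fun t ht => sameCycle_mul_swap_or (hρα s₀ hs₀ t ht)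
    intro t ht
    by_cases hst : SameCycle (α * ρ * swap s₀ s₁) s t
    · exact hself.symm.trans (sameCycle_mul_swap_of_sameCycle hαs hst)
    · refine sameCycle_mul_swap_of_sameCycle hαs ?_
      rcases hs01 with rfl | rfl
      · exact ((hcover s₂ hs₂).resolve_left hαs).symm.trans ((hcover t ht).resolve_left hst)
      · exact ((hcover s₂ hs₂).resolve_right hαs).symm.trans ((hcover t ht).resolve_right hst)
  have hassoc : ∀ γ : Perm W, γ * (ρ * swap s₀ s₁ * swap s s₂) =
      γ * ρ * swap s₀ s₁ * swap s s₂ := fun γ => by simp only [mul_assoc]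
  have hle := hmax (ρ * swap s₀ s₁ * swap s s₂) ⟨fun u hu => by
      have hne : ∀ t ∈ S, u ≠ t := fun t ht h => hu (h ▸ ht)
      rw [Perm.mul_apply, swap_apply_of_ne_of_ne (hne s hs) (hne s₂ hs₂), Perm.mul_apply,
        swap_apply_of_ne_of_ne (hne s₀ hs₀) (hne s₁ hs₁), hρ u hu],
    fun t ht t' ht' => by rw [hassoc]; exact (hαS t ht).symm.trans (hαS t' ht'),
    fun u => by
      obtain ⟨t, ht, hut⟩ := hρβ u
      exact ⟨t, ht, by rw [hassoc]; exact hmono hut⟩,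
    by rw [Perm.sign_mul, Perm.sign_mul, hρsign, sign_swap hne01, sign_swap hnes]; decide⟩
  refine absurd hle (not_le.2 (Set.ncard_lt_ncard ⟨fun v hv => ?_, fun hsub => h01 ?_⟩))
  · change SameCycle (β * (ρ * swap s₀ s₁ * swap s s₂)) s₀ v
    rw [hassoc]; exact hmono hv
  · refine hsub (?_ : SameCycle (β * (ρ * swap s₀ s₁ * swap s s₂)) s₀ s₁)
    rw [hassoc]
    exact sameCycle_mul_swap_of_sameCycle hβs (sameCycle_mul_swap_self h01)

end Transitive

section PartialMaps

/-- The relation `r` has no infinite forward path. -/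
def NoRay {V : Type*} (r : V → V → Prop) : Prop := ∀ m : ℕ → V, ¬ ∀ k, r (m k) (m (k + 1))

variable {W : Type*}

theorem NoRay.exists_sameCycle {r : W → W → Prop} (hr : NoRay r) {f : Perm W}
    (hf : ∀ v u, r v u → f v = u) (w : W) : ∃ s ∈ {s | ¬ ∃ u, r s u}, SameCycle f w s := by
  by_contra hcon
  refine hr (fun k => (f ^ k) w) fun k => ?_
  have hk : ∃ u, r ((f ^ k) w) u := by
    by_contra h
    exact hcon ⟨(f ^ k) w, h, ⟨k, by simp⟩⟩
  obtain ⟨u, hu⟩ := hk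
  rw [pow_succ', Perm.mul_apply, hf _ _ hu]
  exact hu

theorem exists_perm_extending [Finite W] {r : W → W → Prop}
    (hfun : ∀ v u u', r v u → r v u' → u = u') (hinj : ∀ v v' u, r v u → r v' u → v = v') :
    ∃ f : Perm W, ∀ v u, r v u → f v = u := by
  classical
  cases nonempty_fintype W
  choose! F hF using fun (v : W) (h : ∃ u, r v u) => h
  obtain ⟨e, he⟩ := Finset.exists_equiv_extend_of_card_eq (α := W) (t := (Finset.univ : Finset W))
    (s := {v | ∃ u, r v u}) (f := F) rfl (Finset.subset_univ _) (by
      intro v hv v' hv' h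
      simp only [Finset.coe_filter, Finset.mem_univ, true_and, Set.mem_ofPred_eq] at hv hv'
      exact hinj _ _ _ (hF v hv) (h ▸ hF v' hv'))
  refine ⟨e.trans (Equiv.subtypeUnivEquiv (by simp)), fun v u h => ?_⟩
  have := he v (by simpa using ⟨u, h⟩)
  simpa [this] using hfun _ _ _ (hF v ⟨u, h⟩) h

theorem isFullCycle_of_sameCycle {f : Perm W} {S : Set W} (hS : ∀ w, ∃ s ∈ S, SameCycle f w s)
    (hf : ∀ s ∈ S, ∀ t ∈ S, SameCycle f s t) : IsFullCycle f := fun u w => by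
  obtain ⟨s, hs, hus⟩ := hS u
  obtain ⟨t, ht, hwt⟩ := hS w
  exact (hus.trans (hf s hs t ht)).trans hwt.symm

theorem exists_isFullCycle_extending [Finite W] {r : W → W → Prop}
    (hfun : ∀ v u u', r v u → r v u' → u = u') (hinj : ∀ v v' u, r v u → r v' u → v = v')
    (hr : NoRay r) : ∃ f : Perm W, (∀ v u, r v u → f v = u) ∧ IsFullCycle f := by
  obtain ⟨f, hf⟩ := exists_perm_extending hfun hinj
  obtain ⟨ρ, hρ, hfull⟩ := exists_isFullCycle_mul f _ (hr.exists_sameCycle hf)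
  refine ⟨f * ρ, fun v u h => ?_, hfull⟩
  rw [Perm.mul_apply, hρ v (fun hv => hv ⟨u, h⟩), hf v u h]

end PartialMaps

section Words

variable {g n : ℕ} {V : Type*}

theorem wordRel_append (R : Letter g n → V → V → Prop) (w w' : LWord g n) (v u : V) :
    wordRel R (w ++ w') v u ↔ ∃ x, wordRel R w v x ∧ wordRel R w' x u := by
  induction w generalizing v with
  | nil => simp [wordRel]
  | cons p w ih =>
    simp only [List.cons_append, wordRel, ih]
    constructor
    · rintro ⟨y, hy, x, hx, hu⟩; exact ⟨x, ⟨y, hy, hx⟩, hu⟩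
    · rintro ⟨x, ⟨y, hy, hx⟩, hu⟩; exact ⟨y, hy, x, hx, hu⟩

theorem wordRel_map {V' : Type*} {R : Letter g n → V → V → Prop} {R' : Letter g n → V' → V' → Prop}
    {ι : V → V'} (hι : ∀ ℓ v u, R ℓ v u → R' ℓ (ι v) (ι u)) (w : LWord g n) {v u : V}
    (h : wordRel R w v u) : wordRel R' w (ι v) (ι u) := by
  induction w generalizing v with
  | nil => exact congrArg ι h
  | cons p w ih =>
    obtain ⟨x, hx, hu⟩ := h
    refine ⟨ι x, ?_, ih hu⟩
    rcases p with ⟨ℓ, _ | _⟩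
    · exact hι ℓ x v hx
    · exact hι ℓ v x hx

theorem permEval_cons (P : Letter g n → Perm V) (p : Letter g n × Bool) (w : LWord g n) :
    permEval P (p :: w) = permEval P w * cond p.2 (P p.1) (P p.1)⁻¹ := by
  simp [permEval]

theorem permEval_nil (P : Letter g n → Perm V) : permEval P [] = 1 := by
  simp [permEval]

theorem permEval_append (P : Letter g n → Perm V) (w w' : LWord g n) :
    permEval P (w ++ w') = permEval P w' * permEval P w := by
  simp [permEval]

theorem permEval_congr {P P' : Letter g n → Perm V} {w : LWord g n}
    (h : ∀ p ∈ w, P p.1 = P' p.1) : permEval P w = permEval P' w := by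
  induction w with
  | nil => simp [permEval_nil]
  | cons p w ih =>
    rw [permEval_cons, permEval_cons, ih fun q hq => h q (List.mem_cons_of_mem _ hq),
      h p List.mem_cons_self]

theorem permEval_eq_of_wordRel {R : Letter g n → V → V → Prop} {P : Letter g n → Perm V}
    {w : LWord g n} (hP : ∀ p ∈ w, ∀ v u, R p.1 v u → P p.1 v = u) {v u : V}
    (h : wordRel R w v u) : permEval P w v = u := by
  induction w generalizing v with
  | nil => simpa [permEval_nil, wordRel] using h
  | cons p w ih =>
    obtain ⟨x, hx, hu⟩ := h
    rw [permEval_cons, Perm.mul_apply, ← ih (fun q hq => hP q (List.mem_cons_of_mem _ hq)) hu]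
    congr 1
    have hp := hP p List.mem_cons_self
    rcases p with ⟨ℓ, _ | _⟩
    · exact Perm.inv_eq_iff_eq.2 (hp x v hx).symm
    · exact hp v x hx

theorem permEval_flatten_replicate (P : Letter g n → Perm V) (w : LWord g n) (k : ℕ) :
    permEval P (List.replicate k w).flatten = permEval P w ^ k := by
  induction k with
  | zero => simp [permEval_nil]
  | succ k ih => rw [List.replicate_succ, List.flatten_cons, permEval_append, ih, pow_succ]

theorem noRay_wordRel [Finite V] {R : Letter g n → V → V → Prop} {w : LWord g n}
    (h : ∀ d : ℤ, d ≠ 0 → ∀ v : V, ¬ wordRel R (wordZPow w d) v v) : NoRay (wordRel R w) := by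
  intro m hm
  have hpow : ∀ i k, wordRel R (List.replicate k w).flatten (m i) (m (i + k)) := by
    intro i k
    induction k with
    | zero => simp [wordRel]
    | succ k ih =>
      rw [List.replicate_succ', List.flatten_append, wordRel_append]
      exact ⟨_, ih, by simpa [add_assoc] using hm (i + k)⟩
  obtain ⟨i, j, hij, hmij⟩ := Finite.exists_ne_map_eq_of_infinite m
  wlog hlt : i < j generalizing i j
  · exact this j i hij.symm hmij.symm (by omega)
  refine h ((j - i : ℕ) : ℤ) (by omega) (m i) ?_
  have := hpow i (j - i)
  rw [show i + (j - i) = j by omega, ← hmij] at this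
  simpa [wordZPow] using this

end Words

section Extensions

variable {g n : ℕ}

/-- The letters act by partial injections. -/
def IsFolded {V : Type} (R : Letter g n → V → V → Prop) : Prop :=
  (∀ ℓ v u u', R ℓ v u → R ℓ v u' → u = u') ∧ ∀ ℓ v v' u, R ℓ v u → R ℓ v' u → v = v'

/-- An extension of a folded graph creating no new reduced path between old vertices, no new ray
and no new edge labeled by the letter `z`. -/
structure IsFaithfulExt (z : Letter g n) {V V' : Type} (R : Letter g n → V → V → Prop)
    (R' : Letter g n → V' → V' → Prop) (ι : V → V') : Prop where
  injective : Function.Injective ι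
  map : ∀ ℓ v u, R ℓ v u → R' ℓ (ι v) (ι u)
  faithful : ∀ w, FreeGroup.IsReduced w → ∀ v u, wordRel R' w (ι v) (ι u) → wordRel R w v u
  special : ∀ x y, R' z x y → ∃ v u, x = ι v ∧ y = ι u ∧ R z v u
  noRay : ∀ ℓ, NoRay (R ℓ) → NoRay (R' ℓ)
  folded : IsFolded R → IsFolded R'

theorem IsFaithfulExt.trans {z : Letter g n} {V V' V'' : Type} {R : Letter g n → V → V → Prop}
    {R' : Letter g n → V' → V' → Prop} {R'' : Letter g n → V'' → V'' → Prop} {ι : V → V'}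
    {ι' : V' → V''} (h' : IsFaithfulExt z R' R'' ι') (h : IsFaithfulExt z R R' ι) :
    IsFaithfulExt z R R'' (ι' ∘ ι) where
  injective := h'.injective.comp h.injective
  map ℓ v u hvu := h'.map _ _ _ (h.map _ _ _ hvu)
  faithful w hw v u hvu := h.faithful w hw v u (h'.faithful w hw _ _ hvu)
  special x y hxy := by
    obtain ⟨x', y', rfl, rfl, hxy'⟩ := h'.special x y hxy
    obtain ⟨v, u, rfl, rfl, hvu⟩ := h.special x' y' hxy'
    exact ⟨v, u, rfl, rfl, hvu⟩
  noRay ℓ hℓ := h'.noRay ℓ (h.noRay ℓ hℓ)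
  folded hR := h'.folded (h.folded hR)

/-- Attach to a graph on `V` new leaves `u : U` by edges labeled `p` from `v` to `u` whenever
`φ v u`. -/
def attach {V U : Type} (R : Letter g n → V → V → Prop) (p : Letter g n × Bool)
    (φ : V → U → Prop) (ℓ : Letter g n) : V ⊕ U → V ⊕ U → Prop
  | Sum.inl v, Sum.inl u => R ℓ v u
  | Sum.inl v, Sum.inr u => p = (ℓ, true) ∧ φ v u
  | Sum.inr u, Sum.inl v => p = (ℓ, false) ∧ φ v u
  | Sum.inr _, Sum.inr _ => False

variable {V U : Type} {R : Letter g n → V → V → Prop} {p : Letter g n × Bool} {φ : V → U → Prop}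

theorem letterRel_attach_inl_inl {q : Letter g n × Bool} {v u : V} :
    letterRel (attach R p φ) q (Sum.inl v) (Sum.inl u) ↔ letterRel R q v u := by
  rcases q with ⟨ℓ, _ | _⟩ <;> rfl

theorem letterRel_attach_inl_inr {q : Letter g n × Bool} {v : V} {u : U} :
    letterRel (attach R p φ) q (Sum.inl v) (Sum.inr u) ↔ p = q ∧ φ v u := by
  rcases q with ⟨ℓ, _ | _⟩ <;> rfl

theorem letterRel_attach_inr {q : Letter g n × Bool} {u : U} {y : V ⊕ U}
    (h : letterRel (attach R p φ) q (Sum.inr u) y) : p.1 = q.1 ∧ p.2 ≠ q.2 := by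
  rcases q with ⟨ℓ, _ | _⟩ <;> rcases y with y | y <;> simp_all [letterRel, attach]

theorem isFaithfulExt_attach {z : Letter g n} (hφfun : ∀ v u u', φ v u → φ v u' → u = u')
    (hφinj : ∀ v v' u, φ v u → φ v' u → v = v')
    (hφ : ∀ v u, φ v u → p.1 ≠ z ∧ ¬ ∃ v', letterRel R p v v') :
    IsFaithfulExt z R (attach R p φ) Sum.inl where
  injective := Sum.inl_injective
  map _ _ _ h := h
  faithful w := by
    induction w with
    | nil => intro _ v u h; exact Sum.inl_injective h
    | cons q w ih =>
      rintro hw v u ⟨x | x, hx, hxu⟩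
      · refine ⟨x, letterRel_attach_inl_inl.1 hx, ih ?_ _ _ hxu⟩
        exact List.IsChain.tail hw
      · obtain ⟨rfl, -⟩ := letterRel_attach_inl_inr.1 hx
        rcases w with _ | ⟨q, w⟩
        · exact absurd hxu (by simp [wordRel])
        · obtain ⟨y, hy, -⟩ := hxu
          obtain ⟨h1, h2⟩ := letterRel_attach_inr hy
          exact absurd ((List.isChain_cons_cons.1 hw).1 h1) h2
  special x y h := by
    rcases x with x | x <;> rcases y with y | y
    · exact ⟨x, y, rfl, rfl, h⟩
    · exact absurd (by rw [h.1]) (hφ _ _ h.2).1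
    · exact absurd (by rw [h.1]) (hφ _ _ h.2).1
    · exact h.elim
  noRay ℓ hℓ m hm := by
    have hinl : ∀ k, ∃ v, m (k + 1) = Sum.inl v := by
      intro k
      rcases hk : m (k + 1) with v | u
      · exact ⟨v, rfl⟩
      · have h1 := hm k
        have h2 := hm (k + 1)
        rw [hk] at h1 h2
        have h3 := letterRel_attach_inr (q := (ℓ, true)) h2
        have h4 := letterRel_attach_inr (q := (ℓ, false)) h1
        rcases h : p.2 <;> simp_all
    choose m' hm' using hinl
    refine hℓ m' fun k => ?_
    have := hm (k + 1)
    rwa [hm', hm'] at this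
  folded hR := by
    refine ⟨fun ℓ x y y' h h' => ?_, fun ℓ x x' y h h' => ?_⟩
    · rcases x with x | x <;> rcases y with y | y <;> rcases y' with y' | y'
      · exact congrArg _ (hR.1 ℓ x y y' h h')
      · exact absurd ⟨y, by rw [h'.1]; exact h⟩ (hφ _ _ h'.2).2
      · exact absurd ⟨y', by rw [h.1]; exact h'⟩ (hφ _ _ h.2).2
      · exact congrArg _ (hφfun _ _ _ h.2 h'.2)
      · exact congrArg _ (hφinj _ _ _ h.2 h'.2)
      all_goals first | exact h.elim | exact h'.elim
    · rcases x with x | x <;> rcases y with y | y <;> rcases x' with x' | x'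
      · exact congrArg _ (hR.2 ℓ x x' y h h')
      · exact absurd ⟨x, by rw [h'.1]; exact h⟩ (hφ _ _ h'.2).2
      · exact congrArg _ (hφinj _ _ _ h.2 h'.2)
      · exact h'.elim
      · exact absurd ⟨x', by rw [h.1]; exact h'⟩ (hφ _ _ h.2).2
      · exact congrArg _ (hφfun _ _ _ h.2 h'.2)
      all_goals exact h.elim

theorem isFaithfulExt_id (z : Letter g n) (R : Letter g n → V → V → Prop) :
    IsFaithfulExt z R R id :=
  ⟨Function.injective_id, fun _ _ _ h => h, fun _ _ _ _ h => h,
    fun x y h => ⟨x, y, rfl, rfl, h⟩, fun _ h => h, fun h => h⟩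

/-- A finite folded graph has a finite faithful extension in which a given word avoiding the
letter `z` can be evaluated at all old vertices. -/
theorem exists_isFaithfulExt_wordRel (z : Letter g n) (w : LWord g n) (hw : ∀ p ∈ w, p.1 ≠ z)
    {V : Type} [Finite V] (R : Letter g n → V → V → Prop) :
    ∃ (V' : Type) (_ : Finite V') (R' : Letter g n → V' → V' → Prop) (ι : V → V'),
      IsFaithfulExt z R R' ι ∧ ∀ v, ∃ y, wordRel R' w (ι v) y := by
  induction w generalizing V with
  | nil => exact ⟨V, inferInstance, R, id, isFaithfulExt_id z R, fun v => ⟨v, rfl⟩⟩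
  | cons p w ih =>
    have hatt : IsFaithfulExt z R
        (attach R p fun v u => v = u ∧ ¬ ∃ v', letterRel R p v v') Sum.inl :=
      isFaithfulExt_attach (fun v u u' h h' => h.1.symm.trans h'.1)
        (fun v v' u h h' => h.1.trans h'.1.symm) (fun v u h => ⟨hw p List.mem_cons_self, h.2⟩)
    obtain ⟨V', hV', R', ι, hext, hdef⟩ := ih (fun q hq => hw q (List.mem_cons_of_mem _ hq))
      (attach R p fun v u => v = u ∧ ¬ ∃ v', letterRel R p v v')
    refine ⟨V', hV', R', ι ∘ Sum.inl, hext.trans hatt, fun v => ?_⟩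
    obtain ⟨x, hx⟩ : ∃ x, letterRel
        (attach R p fun v u => v = u ∧ ¬ ∃ v', letterRel R p v v') p (Sum.inl v) x := by
      by_cases h : ∃ v', letterRel R p v v'
      · obtain ⟨v', h⟩ := h
        exact ⟨Sum.inl v', letterRel_attach_inl_inl.2 h⟩
      · exact ⟨Sum.inr v, letterRel_attach_inl_inr.2 ⟨rfl, rfl, h⟩⟩
    obtain ⟨y, hy⟩ := hdef x
    refine ⟨y, ι x, ?_, hy⟩
    rcases p with ⟨ℓ, _ | _⟩
    · exact hext.map ℓ _ _ hx
    · exact hext.map ℓ _ _ hx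

theorem exists_isFaithfulExt_odd (z : Letter g n) {V : Type} [Finite V]
    (R : Letter g n → V → V → Prop) :
    ∃ (V' : Type) (_ : Finite V') (R' : Letter g n → V' → V' → Prop) (ι : V → V'),
      IsFaithfulExt z R R' ι ∧ Odd (Nat.card V') := by
  by_cases hodd : Odd (Nat.card V)
  · exact ⟨V, inferInstance, R, id, isFaithfulExt_id z R, hodd⟩
  · refine ⟨V ⊕ Unit, inferInstance, attach R (z, true) fun _ _ => False, Sum.inl,
      isFaithfulExt_attach (by simp) (by simp) (by simp), ?_⟩
    rw [Nat.card_sum]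
    simpa using (Nat.not_odd_iff_even.1 hodd).add_one

/-- A finite folded graph has a faithful extension, of odd cardinality, in which given words
avoiding the letter `z` can be evaluated at all old vertices. -/
theorem exists_isFaithfulExt_two_words (z : Letter g n) (w₁ w₂ : LWord g n)
    (hw₁ : ∀ p ∈ w₁, p.1 ≠ z) (hw₂ : ∀ p ∈ w₂, p.1 ≠ z)
    {V : Type} [Finite V] (R : Letter g n → V → V → Prop) :
    ∃ (V' : Type) (_ : Finite V') (R' : Letter g n → V' → V' → Prop) (ι : V → V'),
      IsFaithfulExt z R R' ι ∧ (∀ v, ∃ y, wordRel R' w₁ (ι v) y) ∧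
        (∀ v, ∃ y, wordRel R' w₂ (ι v) y) ∧ Odd (Nat.card V') := by
  obtain ⟨V₁, _, R₁, ι₁, hext₁, hdef₁⟩ := exists_isFaithfulExt_wordRel z w₁ hw₁ R
  obtain ⟨V₂, _, R₂, ι₂, hext₂, hdef₂⟩ := exists_isFaithfulExt_wordRel z w₂ hw₂ R₁
  obtain ⟨V₃, hV₃, R₃, ι₃, hext₃, hodd⟩ := exists_isFaithfulExt_odd z R₂
  refine ⟨V₃, hV₃, R₃, ι₃ ∘ ι₂ ∘ ι₁, hext₃.trans (hext₂.trans hext₁), fun v => ?_, fun v => ?_,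
    hodd⟩
  · obtain ⟨y, hy⟩ := hdef₁ v
    exact ⟨_, wordRel_map hext₃.map _ (wordRel_map hext₂.map _ hy)⟩
  · obtain ⟨y, hy⟩ := hdef₂ (ι₁ v)
    exact ⟨_, wordRel_map hext₃.map _ hy⟩

/-- If words of the extension can be evaluated at the old vertex `ι v`, and the letters act by
permutations extending it, then the word can already be evaluated in the old graph whenever it
leads to an old vertex. -/
theorem IsFaithfulExt.wordRel_of_permEval {z : Letter g n} {V V' : Type}
    {R : Letter g n → V → V → Prop} {R' : Letter g n → V' → V' → Prop} {ι : V → V'}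
    (h : IsFaithfulExt z R R' ι) {P : Letter g n → Perm V'} {w : LWord g n}
    (hw : FreeGroup.IsReduced w) (hP : ∀ p ∈ w, ∀ v u, R' p.1 v u → P p.1 v = u) {v u : V}
    (hdef : ∃ y, wordRel R' w (ι v) y) (hu : permEval P w (ι v) = ι u) : wordRel R w v u := by
  obtain ⟨y, hy⟩ := hdef
  have := permEval_eq_of_wordRel hP hy
  exact h.faithful w hw v u (by rw [← hu, this]; exact hy)

end Extensions

section Completion

variable {g n : ℕ}

theorem NoRay.wordRel_rotate {V : Type*} {R : Letter g n → V → V → Prop} {w w' : LWord g n}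
    (h : NoRay (wordRel R (w ++ w'))) : NoRay (wordRel R (w' ++ w)) := by
  intro m hm
  choose x hx using fun k => (wordRel_append R w' w (m k) (m (k + 1))).1 (hm k)
  exact h x fun k => (wordRel_append R w w' _ _).2 ⟨m (k + 1), (hx k).2, (hx (k + 1)).1⟩

theorem isReduced_singleton (p : Letter g n × Bool) : FreeGroup.IsReduced [p] :=
  List.isChain_singleton p

/-- A graph containing a `z`-labeled partial injection can be completed so that both `z` and a
word in which `z` occurs exactly once act as full cycles. -/
theorem exists_completion_of_single_occurrence (z : Letter g n) (K : Set (Letter g n))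
    (C Y : LWord g n) (hC : ∀ p ∈ C, p.1 ≠ z) (hY : ∀ p ∈ Y, p.1 ≠ z)
    (hred : FreeGroup.IsReduced (Y ++ C))
    (hsign : ∀ (W : Type) [Fintype W] [DecidableEq W] (P : Letter g n → Perm W),
      Odd (Fintype.card W) → (∀ ℓ ∈ K, IsFullCycle (P ℓ)) → sign (permEval P (Y ++ C)) = 1)
    {V : Type} [Finite V] {R : Letter g n → V → V → Prop} (hR : IsFolded R)
    (hz : NoRay (R z)) (hK : ∀ ℓ ∈ K, NoRay (R ℓ))
    (hray : NoRay (wordRel R (C ++ (z, true) :: Y))) :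
    ∃ (W : Type) (_ : Fintype W) (ι : V ↪ W) (P : Letter g n → Perm W),
      (∀ ℓ v u, R ℓ v u → P ℓ (ι v) = ι u) ∧ IsFullCycle (P z) ∧ (∀ ℓ ∈ K, IsFullCycle (P ℓ)) ∧
        IsFullCycle (permEval P (C ++ (z, true) :: Y)) := by
  classical
  have hYC : ∀ p ∈ Y ++ C, p.1 ≠ z := fun p hp =>
    (List.mem_append.1 hp).elim (hY p) (hC p)
  obtain ⟨W, _, R', ι, hext, hdef, -, hodd⟩ :=
    exists_isFaithfulExt_two_words z (Y ++ C) [] hYC (by simp) R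
  cases nonempty_fintype W
  rw [Nat.card_eq_fintype_card] at hodd
  obtain ⟨hfun, hinj⟩ := hext.folded hR
  have hP : ∀ ℓ, ∃ f : Perm W, (∀ v u, R' ℓ v u → f v = u) ∧ (NoRay (R ℓ) → IsFullCycle f) := by
    intro ℓ
    by_cases h : NoRay (R ℓ)
    · obtain ⟨f, hf, hfull⟩ := exists_isFullCycle_extending (hfun ℓ) (hinj ℓ) (hext.noRay ℓ h)
      exact ⟨f, hf, fun _ => hfull⟩
    · obtain ⟨f, hf⟩ := exists_perm_extending (hfun ℓ) (hinj ℓ)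
      exact ⟨f, hf, fun h' => absurd h' h⟩
  choose P hPext hPfull using hP
  have hmeet : ∀ w, ∃ s ∈ {s | ¬ ∃ u, R' z s u},
      SameCycle (permEval P (Y ++ C) * P z) w s := by
    intro w
    by_contra hcon
    set β := permEval P (Y ++ C) * P z with hβ
    have hout : ∀ k : ℕ, ∃ v u, (β ^ k) w = ι v ∧ P z (ι v) = ι u ∧ R z v u := by
      intro k
      have : ∃ u, R' z ((β ^ k) w) u := by
        by_contra h
        exact hcon ⟨(β ^ k) w, h, ⟨k, by simp⟩⟩
      obtain ⟨y, hy⟩ := this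
      obtain ⟨v, u, hv, hu, hvu⟩ := hext.special _ _ hy
      exact ⟨v, u, hv, hPext z _ _ (hext.map z _ _ hvu), hvu⟩
    choose v u hv hu hvu using hout
    refine hray.wordRel_rotate v fun k => ⟨u k, hvu k, ?_⟩
    refine hext.wordRel_of_permEval hred (fun p _ => hPext p.1) (hdef (u k)) ?_
    rw [← hv (k + 1), pow_succ', Perm.mul_apply, hv, hβ, Perm.mul_apply, hu]
  obtain ⟨ρ, hρ, hcyc, hfull⟩ := exists_isFullCycle_mul_of_sign (P z)
    (permEval P (Y ++ C) * P z) {s | ¬ ∃ u, R' z s u} (fun _ _ _ _ => hPfull z hz _ _) hmeet hodd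
    (by rw [Perm.sign_mul, hsign W P hodd fun ℓ hℓ => hPfull ℓ (hK ℓ hℓ),
      (hPfull z hz).sign_eq_one hodd, one_mul])
  have hnew : ∀ x y, R' z x y → (P z * ρ) x = y := fun x y h => by
    rw [Perm.mul_apply, hρ x fun hx => hx ⟨y, h⟩, hPext z x y h]
  have hzfull : IsFullCycle (P z * ρ) :=
    isFullCycle_of_sameCycle ((hext.noRay z hz).exists_sameCycle hnew) hcyc
  have hupd : ∀ w : LWord g n, (∀ p ∈ w, p.1 ≠ z) →
      permEval (Function.update P z (P z * ρ)) w = permEval P w := fun w hw =>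
    permEval_congr fun p hp => Function.update_of_ne (hw p hp) _ _
  refine ⟨W, inferInstance, ⟨ι, hext.injective⟩, Function.update P z (P z * ρ),
    fun ℓ v u h => ?_, by simpa using hzfull, fun ℓ hℓ => ?_, ?_⟩
  · by_cases hℓ : ℓ = z
    · subst hℓ
      simpa using hnew _ _ (hext.map _ _ _ h)
    · simpa [hℓ] using hPext _ _ _ (hext.map _ _ _ h)
  · by_cases hℓz : ℓ = z
    · subst hℓz
      simpa using hzfull
    · simpa [hℓz] using hPfull ℓ (hK ℓ hℓ)
  · rw [permEval_append, permEval_cons, hupd Y hY, hupd C hC]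
    convert hfull.conj (permEval P C)⁻¹ using 1
    simp [permEval_append, mul_assoc]

theorem permEval_eq_one {W : Type*} {P : Letter g n → Perm W} {w : LWord g n}
    (h : ∀ p ∈ w, P p.1 = 1) : permEval P w = 1 := by
  induction w with
  | nil => exact permEval_nil P
  | cons p w ih =>
    rw [permEval_cons, ih fun q hq => h q (List.mem_cons_of_mem _ hq), h p List.mem_cons_self]
    cases p.2 <;> simp

theorem permEval_sumCongr {A B : Type*} (P : Letter g n → Perm A) (Q : Letter g n → Perm B)
    (w : LWord g n) : permEval (fun ℓ => Perm.sumCongr (P ℓ) (Q ℓ)) w =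
      Perm.sumCongr (permEval P w) (permEval Q w) := by
  induction w with
  | nil => simp [permEval_nil]
  | cons p w ih =>
    rw [permEval_cons, permEval_cons, permEval_cons, ih]
    cases p.2 <;> simp

theorem SameCycle.sumCongr_inr {A B : Type*} (f : Perm A) {h : Perm B} {x y : B}
    (hxy : SameCycle h x y) : SameCycle (Perm.sumCongr f h) (Sum.inr x) (Sum.inr y) := by
  obtain ⟨k, rfl⟩ := hxy
  refine ⟨k, ?_⟩
  have : Perm.sumCongr f h ^ k = Perm.sumCongr (f ^ k) (h ^ k) :=
    (map_zpow (Perm.sumCongrHom A B) (f, h) k).symm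
  rw [this]
  rfl

theorem IsFullCycle.isConj {W : Type*} [Finite W] {f h : Perm W} (hf : IsFullCycle f)
    (hh : IsFullCycle h) : IsConj f h := by
  classical
  cases nonempty_fintype W
  rcases subsingleton_or_nontrivial W with _ | _
  · rw [Subsingleton.elim f h]
  · have key : ∀ {f : Perm W}, IsFullCycle f → f.IsCycle ∧ f.support = Finset.univ := by
      intro f hf
      have hne : ∀ x, f x ≠ x := fun x hx => by
        obtain ⟨y, hy⟩ := exists_ne x
        exact hy ((hf x y).eq_of_left hx).symm
      obtain ⟨x⟩ : Nonempty W := inferInstance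
      exact ⟨⟨x, hne x, fun y _ => hf x y⟩, Finset.eq_univ_of_forall fun y => by simpa using hne y⟩
    exact (key hf).1.isConj (key hh).1 (by rw [(key hf).2, (key hh).2])

/-- Two permutations which agree off an invariant set `S` and are both transitive on `S` are
conjugate by a permutation supported on `S`. -/
theorem exists_conj_eq_of_agree_off {W : Type*} [Finite W] {c c' : Perm W} {S : Set W}
    (hS : ∀ w, c w ∈ S ↔ w ∈ S) (hS' : ∀ w, c' w ∈ S ↔ w ∈ S) (hcc' : ∀ w, w ∉ S → c w = c' w)
    (hc : ∀ s ∈ S, ∀ t ∈ S, SameCycle c s t) (hc' : ∀ s ∈ S, ∀ t ∈ S, SameCycle c' s t) :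
    ∃ κ : Perm W, (∀ w, w ∉ S → κ w = w) ∧ κ⁻¹ * c * κ = c' := by
  classical
  have hconj : IsConj (c'.subtypePerm hS') (c.subtypePerm hS) :=
    IsFullCycle.isConj (fun u w => sameCycle_subtypePerm.2 (hc' _ u.2 _ w.2))
      fun u w => sameCycle_subtypePerm.2 (hc _ u.2 _ w.2)
  obtain ⟨k, hk⟩ := isConj_iff.1 hconj
  have hfix : ∀ w, w ∉ S → ofSubtype k w = w := fun w hw => ofSubtype_apply_of_not_mem k hw
  refine ⟨ofSubtype k, hfix, ?_⟩
  rw [mul_assoc, inv_mul_eq_iff_eq_mul]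
  ext w
  rw [Perm.mul_apply, Perm.mul_apply]
  by_cases hw : w ∈ S
  · have := congrArg Subtype.val (Perm.ext_iff.1 (mul_inv_eq_iff_eq_mul.1 hk) ⟨w, hw⟩)
    rw [ofSubtype_apply_of_mem k hw, ofSubtype_apply_of_mem k ((hS' w).2 hw)]
    exact this.symm
  · rw [hfix w hw, hfix _ fun h => hw ((hS' w).1 h), hcc' w hw]

/-- A partial injection `q` of `U` extends to a permutation of `U ⊕ T` with no further arrow inside
`U`, and there is a full cycle of `T` which maps arrows from `T` to `U` to arrows inside `T`. -/
theorem exists_perm_sum_extending {U : Type} [Finite U] {q : U → U → Prop}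
    (hfun : ∀ v u u', q v u → q v u' → u = u') (hinj : ∀ v v' u, q v u → q v' u → v = v') :
    ∃ (T : Type) (_ : Fintype T) (τ : Perm T) (β : Perm (U ⊕ T)), Even (Fintype.card T) ∧
      IsFullCycle τ ∧ (∀ v u, β (Sum.inl v) = Sum.inl u ↔ q v u) ∧
        ∀ t u, β (Sum.inr t) = Sum.inl u → ∃ s, β (Sum.inr (τ t)) = Sum.inr s := by
  classical
  cases nonempty_fintype U
  let T₁ := {t : U // ¬ ∃ u, q u t}
  obtain ⟨τ, hτ, hτfull⟩ := exists_isFullCycle_extending (W := T₁ × Bool)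
    (r := fun x y => ∃ t, x = (t, false) ∧ y = (t, true))
    (by rintro _ _ _ ⟨t, rfl, rfl⟩ ⟨t', h, rfl⟩; simp_all)
    (by rintro _ _ _ ⟨t, rfl, rfl⟩ ⟨t', rfl, h⟩; simp_all)
    (by
      intro m hm
      obtain ⟨t, -, h⟩ := hm 0
      obtain ⟨t', h', -⟩ := hm 1
      simp_all)
  let r : U ⊕ T₁ × Bool → U ⊕ T₁ × Bool → Prop := fun x y =>
    (∃ v u, x = Sum.inl v ∧ y = Sum.inl u ∧ q v u) ∨
      ∃ t : T₁, x = Sum.inr (t, false) ∧ y = Sum.inl t.1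
  obtain ⟨β, hβ⟩ := exists_perm_extending (r := r)
    (by
      rintro x y y' (⟨v, u, rfl, rfl, h⟩ | ⟨t, rfl, rfl⟩) (⟨v', u', hv, rfl, h'⟩ | ⟨t', ht, rfl⟩)
      · obtain rfl := Sum.inl_injective hv
        rw [hfun _ _ _ h h']
      · exact absurd ht (by simp)
      · exact absurd hv (by simp)
      · obtain rfl : t = t' := (Prod.ext_iff.1 (Sum.inr_injective ht)).1
        rfl)
    (by
      rintro x x' y (⟨v, u, rfl, rfl, h⟩ | ⟨t, rfl, rfl⟩) (⟨v', u', rfl, hu, h'⟩ | ⟨t', rfl, ht⟩)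
      · obtain rfl := Sum.inl_injective hu
        rw [hinj _ _ _ h h']
      · exact absurd ⟨v, by rwa [← Sum.inl_injective ht]⟩ t'.2
      · exact absurd ⟨v', by rwa [Sum.inl_injective hu]⟩ t.2
      · rw [Subtype.ext (Sum.inl_injective ht)])
  have hr : ∀ x u, β x = Sum.inl u → r x (Sum.inl u) := by
    intro x u hx
    obtain ⟨x', hx'⟩ : ∃ x', r x' (Sum.inl u) := by
      by_cases h : ∃ v, q v u
      · obtain ⟨v, h⟩ := h
        exact ⟨Sum.inl v, Or.inl ⟨v, u, rfl, rfl, h⟩⟩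
      · exact ⟨Sum.inr (⟨u, h⟩, false), Or.inr ⟨⟨u, h⟩, rfl, rfl⟩⟩
    rwa [β.injective (hx.trans (hβ _ _ hx').symm)]
  refine ⟨T₁ × Bool, inferInstance, τ, β, ?_, hτfull, fun v u => ⟨fun h => ?_, fun h => ?_⟩,
    fun t u h => ?_⟩
  · rw [Fintype.card_prod, Fintype.card_bool]
    exact even_two.mul_left _
  · rcases hr _ _ h with ⟨v', u', hv, hu, h⟩ | ⟨t, ht, -⟩
    · rwa [Sum.inl_injective hv, Sum.inl_injective hu]
    · exact absurd ht (by simp)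
  · exact hβ _ _ (Or.inl ⟨v, u, rfl, rfl, h⟩)
  · rcases hr _ _ h with ⟨v', u', hv, -⟩ | ⟨t', ht, -⟩
    · exact absurd hv (by simp)
    · rw [Sum.inr_injective ht, hτ _ _ ⟨t', rfl, rfl⟩]
      rcases hy : β (Sum.inr (t', true)) with u' | s
      · rcases hr _ _ hy with ⟨_, _, h, -⟩ | ⟨_, h, -⟩
        · exact absurd h (by simp)
        · exact absurd (Prod.ext_iff.1 (Sum.inr_injective h)).2 (by simp)
      · exact ⟨s, rfl⟩

/-- Given permutations `p`, `σ` and a partial injection `q` of `U` such that the partial map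
`p σ q⁻¹ p⁻¹ q` has no ray, one can extend all of them to permutations of some `U ⊕ T`, with `σ`
acting trivially on `T`, so that `σ q⁻¹ p⁻¹ q p` becomes a full cycle. -/
theorem exists_isFullCycle_commutator {U : Type} [Fintype U] [DecidableEq U]
    (hodd : Odd (Fintype.card U)) {p σ : Perm U} (hσ : sign σ = 1) {q : U → U → Prop}
    (hfun : ∀ v u u', q v u → q v u' → u = u') (hinj : ∀ v v' u, q v u → q v' u → v = v')
    (hray : NoRay fun v v' => ∃ u y, q v u ∧ q y (p⁻¹ u) ∧ v' = p (σ y)) :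
    ∃ (T : Type) (_ : Fintype T) (τ : Perm T) (β : Perm (U ⊕ T)),
      (∀ v u, q v u → β (Sum.inl v) = Sum.inl u) ∧
        IsFullCycle (Perm.sumCongr σ 1 * β⁻¹ * (Perm.sumCongr p τ)⁻¹ * β * Perm.sumCongr p τ) := by
  classical
  obtain ⟨T, _, τ, β, heven, hτ, hq, hβτ⟩ := exists_perm_sum_extending hfun hinj
  let S : Set (U ⊕ T) := {x | ∃ t, β x = Sum.inr t}
  have hoff : ∀ x, x ∉ S → ∃ u, β x = Sum.inl u := fun x hx => by
    rcases h : β x with u | t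
    · exact ⟨u, rfl⟩
    · exact absurd ⟨t, h⟩ hx
  obtain ⟨γ, hγ⟩ : ∃ γ, γ = β⁻¹ * (Perm.sumCongr p τ)⁻¹ * β := ⟨_, rfl⟩
  have hβγ : ∀ x, β (γ x) = Perm.sumCongr p⁻¹ τ⁻¹ (β x) := fun x => by
    rw [hγ, Perm.sumCongr_inv]
    simp
  have hγS : ∀ x, γ x ∈ S ↔ x ∈ S := by
    intro x
    change (∃ t, β (γ x) = Sum.inr t) ↔ ∃ t, β x = Sum.inr t
    rw [hβγ]
    rcases β x with u | t <;> simp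
  have hγcyc : ∀ s ∈ S, ∀ t ∈ S, SameCycle γ s t := by
    rintro s ⟨s', hs⟩ t ⟨t', ht⟩
    have : SameCycle (β⁻¹ * (Perm.sumCongr p τ)⁻¹ * β⁻¹⁻¹) s t := by
      rw [sameCycle_conj, inv_inv, hs, ht, sameCycle_inv]
      exact SameCycle.sumCongr_inr _ (hτ s' t')
    rwa [inv_inv, ← hγ] at this
  obtain ⟨δ, hδ⟩ : ∃ δ, δ = Perm.sumCongr p τ * Perm.sumCongr σ 1 * γ := ⟨_, rfl⟩
  have hstep : ∀ x, x ∉ S → δ x ∉ S →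
      ∃ u y, β x = Sum.inl u ∧ q y (p⁻¹ u) ∧ δ x = Sum.inl (p (σ y)) := by
    intro x hx hδx
    obtain ⟨u, hu⟩ := hoff x hx
    have hγx : β (γ x) = Sum.inl (p⁻¹ u) := by
      rw [hβγ, hu]
      rfl
    rcases hx' : γ x with y | t
    · exact ⟨u, y, hu, (hq _ _).1 (hx' ▸ hγx), by rw [hδ, Perm.mul_apply, hx']; rfl⟩
    · obtain ⟨s, hs⟩ := hβτ t _ (hx' ▸ hγx)
      exact absurd ⟨s, by rw [hδ, Perm.mul_apply, hx']; exact hs⟩ hδx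
  have hmeet : ∀ w, ∃ s ∈ S, SameCycle δ w s := by
    intro w
    by_contra hcon
    have hout : ∀ k : ℕ, (δ ^ k) w ∉ S := fun k h => hcon ⟨(δ ^ k) w, h, ⟨k, by simp⟩⟩
    have hsucc : ∀ k, (δ ^ (k + 1)) w = δ ((δ ^ k) w) := fun k => by
      rw [pow_succ', Perm.mul_apply]
    choose u y hu hy hδy using fun k => hstep _ (hout k) (hsucc k ▸ hout (k + 1))
    refine hray (fun k => p (σ (y k))) fun k => ⟨u (k + 1), y (k + 1), ?_, hy (k + 1), rfl⟩
    rw [← hq, ← hδy, ← hsucc]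
    exact hu (k + 1)
  have hcard : Odd (Fintype.card (U ⊕ T)) := by
    rw [Fintype.card_sum]
    exact hodd.add_even heven
  obtain ⟨ρ, hρ, hcyc, hfull⟩ := exists_isFullCycle_mul_of_sign γ δ S hγcyc hmeet hcard (by
    rw [hδ, hγ]
    simp only [Perm.sign_mul, Perm.sign_inv, Perm.sign_sumCongr, hσ, Perm.sign_one]
    rcases Int.units_eq_one_or (sign p) with h | h <;>
      rcases Int.units_eq_one_or (sign τ) with h' | h' <;>
        rcases Int.units_eq_one_or (sign β) with h'' | h'' <;> simp [h, h', h''])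
  have hρS : ∀ x, ρ x ∈ S ↔ x ∈ S := fun x => by
    by_cases hx : x ∈ S
    · refine iff_of_true ?_ hx
      by_contra h
      rw [ρ.injective (hρ _ h)] at h
      exact h hx
    · rw [hρ x hx]
  obtain ⟨κ, hκ, hκγ⟩ := exists_conj_eq_of_agree_off hγS
    (c' := γ * ρ) (fun x => by rw [Perm.mul_apply, hγS, hρS])
    (fun x hx => by rw [Perm.mul_apply, hρ x hx]) hγcyc hcyc
  refine ⟨T, inferInstance, τ, β * κ, fun v u h => ?_, ?_⟩
  · have := (hq v u).2 h
    rw [Perm.mul_apply, hκ, this]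
    rintro ⟨t, ht⟩
    rw [this] at ht
    exact absurd ht (by simp)
  · convert hfull.conj (Perm.sumCongr p τ)⁻¹ using 1
    rw [hδ, mul_assoc (_ * _) γ ρ, ← hκγ, hγ]
    simp only [mul_inv_rev, inv_inv, mul_assoc, inv_mul_cancel_left]

/-- A graph can be completed so that the product of the commutator of two letters `a`, `z` with a
word in the other letters acts as a full cycle. -/
theorem exists_completion_of_commutator {a z : Letter g n} (haz : a ≠ z) (C : LWord g n)
    (hCa : ∀ p ∈ C, p.1 ≠ a) (hCz : ∀ p ∈ C, p.1 ≠ z)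
    (hred : FreeGroup.IsReduced (C ++ [(a, true)]))
    (hsign : ∀ (W : Type) [Fintype W] [DecidableEq W] (P : Letter g n → Perm W),
      sign (permEval P C) = 1)
    {V : Type} [Finite V] {R : Letter g n → V → V → Prop} (hR : IsFolded R)
    (hray : NoRay (wordRel R ((a, true) :: (z, true) :: (a, false) :: (z, false) :: C))) :
    ∃ (W : Type) (_ : Fintype W) (ι : V ↪ W) (P : Letter g n → Perm W),
      (∀ ℓ v u, R ℓ v u → P ℓ (ι v) = ι u) ∧
        IsFullCycle (permEval P ((a, true) :: (z, true) :: (a, false) :: (z, false) :: C)) := by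
  classical
  have hCa' : ∀ p ∈ C ++ [(a, true)], p.1 ≠ z := fun p hp => by
    rcases List.mem_append.1 hp with hp | hp
    · exact hCz p hp
    · rw [List.mem_singleton.1 hp]; exact haz
  obtain ⟨U, _, R', ι, hext, hdef₁, hdef₂, hodd⟩ :=
    exists_isFaithfulExt_two_words z [(a, false)] (C ++ [(a, true)]) (by simpa using haz) hCa' R
  cases nonempty_fintype U
  rw [Nat.card_eq_fintype_card] at hodd
  obtain ⟨hfun, hinj⟩ := hext.folded hR
  choose P hP using fun ℓ => exists_perm_extending (hfun ℓ) (hinj ℓ)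
  have hray' : NoRay fun v v' => ∃ u y, R' z v u ∧ R' z y ((P a)⁻¹ u) ∧
      v' = P a (permEval P C y) := by
    intro m hm
    choose u y hu hy hmy using hm
    choose v u' hv hu' hvu using fun k => hext.special _ _ (hu k)
    choose y' s hy' hs hys using fun k => hext.special _ _ (hy k)
    refine NoRay.wordRel_rotate (w := [(a, true)])
      (w' := (z, true) :: (a, false) :: (z, false) :: C) hray v fun k => ?_
    have h₁ : wordRel R [(a, false)] (u' k) (s k) :=
      hext.wordRel_of_permEval (isReduced_singleton _) (fun p _ => hP p.1) (hdef₁ _) (by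
        rw [← hs, hu']
        simp [permEval_cons, permEval_nil])
    have h₂ : wordRel R (C ++ [(a, true)]) (y' k) (v (k + 1)) :=
      hext.wordRel_of_permEval hred (fun p _ => hP p.1) (hdef₂ _) (by
        rw [← hv, hmy, hy']
        simp [permEval_append, permEval_cons, permEval_nil])
    obtain ⟨_, h₁, rfl⟩ := h₁
    exact ⟨u' k, hvu k, _, h₁, y' k, hys k, h₂⟩
  obtain ⟨T, _, τ, β, hβ, hfull⟩ :=
    exists_isFullCycle_commutator hodd (hsign U P) (hfun z) (hinj z) hray'
  obtain ⟨Q, hQa, hQ⟩ : ∃ Q : Letter g n → Perm T, Q a = τ ∧ ∀ ℓ, ℓ ≠ a → Q ℓ = 1 :=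
    ⟨Function.update 1 a τ, by simp, fun ℓ hℓ => by simp [hℓ]⟩
  refine ⟨U ⊕ T, inferInstance, ⟨Sum.inl ∘ ι, Sum.inl_injective.comp hext.injective⟩,
    Function.update (fun ℓ => Perm.sumCongr (P ℓ) (Q ℓ)) z β, fun ℓ v u h => ?_, ?_⟩
  · by_cases hℓ : ℓ = z
    · subst hℓ
      simpa using hβ _ _ (hext.map _ _ _ h)
    · simpa [hℓ] using hP _ _ _ (hext.map _ _ _ h)
  · have hC : permEval (Function.update (fun ℓ => Perm.sumCongr (P ℓ) (Q ℓ)) z β) C =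
        Perm.sumCongr (permEval P C) 1 := by
      rw [permEval_congr fun p hp => Function.update_of_ne (hCz p hp) _ _, permEval_sumCongr,
        permEval_eq_one (P := Q) fun p hp => hQ _ (hCa p hp)]
    simpa only [permEval_cons, hC, Function.update_self, Function.update_of_ne haz, hQa, cond_true,
      cond_false] using hfull

end Completion

section BoundaryWords

variable {g n : ℕ}

/-- The commutator of the letters `a_i` and `b_i`. -/
def commWord (g n : ℕ) (i : Fin g) : LWord g n :=
  [(Sum.inl i, true), (Sum.inr (Sum.inl i), true), (Sum.inl i, false), (Sum.inr (Sum.inl i), false)]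

theorem mem_flatMap_commWord {l : List (Fin g)} {p : Letter g n × Bool}
    (hp : p ∈ l.flatMap (commWord g n)) : ∃ i ∈ l, p.1 = Sum.inl i ∨ p.1 = Sum.inr (Sum.inl i) := by
  obtain ⟨i, hi, hp⟩ := List.mem_flatMap.1 hp
  refine ⟨i, hi, ?_⟩
  simp only [commWord, List.mem_cons, List.not_mem_nil, or_false] at hp
  rcases hp with rfl | rfl | rfl | rfl <;> simp

theorem isReduced_flatMap_commWord_append (l : List (Fin g)) {w : LWord g n}
    (hw : FreeGroup.IsReduced w) (hhead : ∀ p ∈ w.head?, ∀ i, p.1 ≠ Sum.inr (Sum.inl i)) :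
    FreeGroup.IsReduced (l.flatMap (commWord g n) ++ w) := by
  induction l with
  | nil => exact hw
  | cons i l ih =>
    rw [List.flatMap_cons, List.append_assoc]
    refine List.isChain_append.2 ⟨?_, ih, ?_⟩
    · simp [commWord]
    · intro x hx y hy hxy
      obtain rfl : (Sum.inr (Sum.inl i), false) = x := by simpa [commWord] using hx
      exfalso
      rcases l with _ | ⟨j, l⟩
      · exact hhead y hy i hxy.symm
      · obtain rfl : (Sum.inl j, true) = y := by simpa [commWord] using hy
        simp at hxy

theorem sign_permEval_flatMap_commWord (l : List (Fin g)) {W : Type*} [Fintype W] [DecidableEq W]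
    (P : Letter g n → Perm W) : sign (permEval P (l.flatMap (commWord g n))) = 1 := by
  induction l with
  | nil => simp [permEval_nil]
  | cons i l ih =>
    rw [List.flatMap_cons, permEval_append, Perm.sign_mul, ih, one_mul]
    simp only [commWord, permEval_cons, permEval_nil, Perm.sign_mul, cond_true, cond_false,
      Perm.sign_inv, Perm.sign_one]
    rcases Int.units_eq_one_or (sign (P (Sum.inl i))) with h | h <;>
      rcases Int.units_eq_one_or (sign (P (Sum.inr (Sum.inl i)))) with h' | h' <;> simp [h, h']

theorem sign_permEval_eq_one {W : Type*} [Fintype W] [DecidableEq W] {P : Letter g n → Perm W}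
    {w : LWord g n} (h : ∀ p ∈ w, sign (P p.1) = 1) : sign (permEval P w) = 1 := by
  induction w with
  | nil => simp [permEval_nil]
  | cons p w ih =>
    have hp := h p List.mem_cons_self
    rw [permEval_cons, Perm.sign_mul, ih fun q hq => h q (List.mem_cons_of_mem _ hq)]
    cases p.2 <;> simp [hp]

theorem xWord_of_lt {b : Fin n} (h : (b : ℕ) < n - 1) :
    xWord g n b = [(Sum.inr (Sum.inr ⟨b, h⟩), true)] := dif_pos h

theorem xWord_of_not_lt {b : Fin n} (h : ¬ (b : ℕ) < n - 1) :
    xWord g n b = (List.finRange g).flatMap (commWord g n) ++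
      (List.finRange (n - 1)).map fun i => ((Sum.inr (Sum.inr i) : Letter g n), true) := by
  rw [xWord, dif_neg h, List.ofFn_eq_map, List.ofFn_eq_map, List.flatMap_def]
  rfl

variable {V : Type} [Finite V] {R : Letter g n → V → V → Prop}

theorem exists_completion_of_two_le (hn : 2 ≤ n) (hR : IsFolded R)
    (hray : ∀ b, NoRay (wordRel R (xWord g n b))) :
    ∃ (W : Type) (_ : Fintype W) (ι : V ↪ W) (P : Letter g n → Perm W),
      (∀ ℓ v u, R ℓ v u → P ℓ (ι v) = ι u) ∧ ∀ b, IsFullCycle (permEval P (xWord g n b)) := by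
  obtain ⟨m, rfl⟩ := Nat.exists_eq_add_of_le' hn
  have hone : ∀ i : Fin (m + 1), NoRay (R (Sum.inr (Sum.inr i))) := fun i => by
    have h := hray i.castSucc
    rw [xWord_of_lt (b := i.castSucc) i.2] at h
    intro k hk
    exact h k fun j => ⟨_, hk j, rfl⟩
  let C := (List.finRange g).flatMap (commWord g (m + 2))
  let Y : LWord g (m + 2) :=
    (List.finRange m).map fun i => (Sum.inr (Sum.inr (Fin.succ i)), true)
  have hlast : ∀ b : Fin (m + 2), ¬ (b : ℕ) < m + 1 →
      xWord g (m + 2) b = C ++ ((Sum.inr (Sum.inr (0 : Fin (m + 1))) : Letter g (m + 2)), true) :: Y := by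
    intro b hb
    rw [xWord_of_not_lt (n := m + 2) hb]
    change C ++ (List.finRange (m + 1)).map _ = _
    rw [List.finRange_succ, List.map_cons, List.map_map]
    rfl
  have hYmem : ∀ p ∈ Y, ∃ i : Fin m, p = (Sum.inr (Sum.inr (Fin.succ i)), true) := fun p hp => by
    obtain ⟨i, -, rfl⟩ := List.mem_map.1 hp
    exact ⟨i, rfl⟩
  obtain ⟨W, hW, ι, P, hP, hz, hK, hfull⟩ := exists_completion_of_single_occurrence
    (Sum.inr (Sum.inr (0 : Fin (m + 1)))) (Set.range fun i : Fin (m + 1) => Sum.inr (Sum.inr i))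
    C Y
    (fun p hp h => by
      obtain ⟨i, -, hi⟩ := mem_flatMap_commWord hp
      rw [h] at hi
      simp at hi)
    (fun p hp h => by
      obtain ⟨i, rfl⟩ := hYmem p hp
      exact Fin.succ_ne_zero i (Sum.inr_injective (Sum.inr_injective h)))
    (by
      refine List.isChain_append.2 ⟨?_, ?_, ?_⟩
      · refine List.Pairwise.isChain (List.pairwise_of_forall_mem_list fun p hp q hq _ => ?_)
        obtain ⟨i, rfl⟩ := hYmem p hp
        obtain ⟨j, rfl⟩ := hYmem q hq
        rfl
      · have := isReduced_flatMap_commWord_append (n := m + 2) (List.finRange g) (w := [])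
          List.isChain_nil (by simp)
        rwa [List.append_nil] at this
      · intro p hp q hq hpq
        obtain ⟨i, rfl⟩ := hYmem p (List.mem_of_mem_getLast? hp)
        obtain ⟨j, -, hj⟩ := mem_flatMap_commWord (List.mem_of_mem_head? hq)
        rw [← hpq] at hj
        simp at hj)
    (fun W _ _ P hodd hfull => by
      rw [permEval_append, Perm.sign_mul, sign_permEval_flatMap_commWord, one_mul]
      refine sign_permEval_eq_one fun p hp => ?_
      obtain ⟨i, rfl⟩ := hYmem p hp
      exact (hfull _ ⟨_, rfl⟩).sign_eq_one hodd)
    hR (hone 0) (by rintro _ ⟨i, rfl⟩; exact hone i)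
    (by
      have := hray (Fin.last (m + 1))
      rwa [hlast _ (by simp)] at this)
  refine ⟨W, hW, ι, P, hP, fun b => ?_⟩
  by_cases hb : (b : ℕ) < m + 1
  · rw [xWord_of_lt (n := m + 2) hb, permEval_cons, permEval_nil, one_mul]
    exact hK _ ⟨⟨b, hb⟩, rfl⟩
  · rw [hlast b hb]
    exact hfull

theorem exists_completion_of_eq_one (hn : n = 1) (hg : 1 ≤ g) (hR : IsFolded R)
    (hray : ∀ b, NoRay (wordRel R (xWord g n b))) :
    ∃ (W : Type) (_ : Fintype W) (ι : V ↪ W) (P : Letter g n → Perm W),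
      (∀ ℓ v u, R ℓ v u → P ℓ (ι v) = ι u) ∧ ∀ b, IsFullCycle (permEval P (xWord g n b)) := by
  subst hn
  obtain ⟨m, rfl⟩ := Nat.exists_eq_add_of_le' hg
  let C := ((List.finRange m).map Fin.succ).flatMap (commWord (m + 1) 1)
  have hx : ∀ b, xWord (m + 1) 1 b = (Sum.inl 0, true) :: (Sum.inr (Sum.inl 0), true) ::
      (Sum.inl 0, false) :: (Sum.inr (Sum.inl 0), false) :: C := by
    intro b
    rw [xWord_of_not_lt (by simp), List.finRange_succ, List.flatMap_cons]
    exact List.append_nil _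
  have hC : ∀ p ∈ C, p.1 ≠ Sum.inl 0 ∧ p.1 ≠ Sum.inr (Sum.inl 0) := fun p hp => by
    obtain ⟨i, hi, hpi⟩ := mem_flatMap_commWord hp
    obtain ⟨j, -, rfl⟩ := List.mem_map.1 hi
    rcases hpi with hpi | hpi <;> rw [hpi] <;> simp
  obtain ⟨W, hW, ι, P, hP, hfull⟩ := exists_completion_of_commutator (R := R)
    (a := Sum.inl 0) (z := Sum.inr (Sum.inl 0)) (by simp) C (fun p hp => (hC p hp).1)
    (fun p hp => (hC p hp).2)
    (isReduced_flatMap_commWord_append _ (isReduced_singleton _) (by simp))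
    (fun W _ _ P => sign_permEval_flatMap_commWord _ P) hR (hx 0 ▸ hray 0)
  exact ⟨W, hW, ι, P, hP, fun b => by rw [hx]; exact hfull⟩

end BoundaryWords

theorem folded_graph_completion
    (g n : ℕ) (hn : 1 ≤ n) (hgen : 1 ≤ 2 * g + (n - 1))
    (V : Type) [Fintype V]
    (R : Letter g n → V → V → Prop)
    (hfun : ∀ ℓ v u u', R ℓ v u → R ℓ v u' → u = u')
    (hinj : ∀ ℓ v v' u, R ℓ v u → R ℓ v' u → v = v')
    (hnoloop : ∀ (b : Fin n) (d' : ℤ), d' ≠ 0 → ∀ v : V,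
      ¬ wordRel R (wordZPow (xWord g n b) d') v v) :
    ∃ (W : Type) (_iW : Fintype W) (ι : V ↪ W) (gp : Letter g n → Equiv.Perm W),
      (∀ (ℓ : Letter g n) (v u : V), R ℓ v u → gp ℓ (ι v) = ι u) ∧
      (∀ w w' : W, ∃ word : LWord g n, permEval gp word w = w') ∧
      (∀ (b : Fin n) (e : ℕ), 1 ≤ e → e ≤ @Fintype.card W _iW - 1 →
        ∀ w : W, (permEval gp (xWord g n b) ^ e) w ≠ w) ∧
      (∀ (word : LWord g n) (v₀ u : V), wordRel R word v₀ u → u ≠ v₀ →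
        permEval gp word (ι v₀) ≠ ι v₀) := by
  have hray : ∀ b, NoRay (wordRel R (xWord g n b)) := fun b => noRay_wordRel (hnoloop b)
  obtain ⟨W, hW, ι, P, hP, hfull⟩ :
      ∃ (W : Type) (_ : Fintype W) (ι : V ↪ W) (P : Letter g n → Perm W),
        (∀ ℓ v u, R ℓ v u → P ℓ (ι v) = ι u) ∧ ∀ b, IsFullCycle (permEval P (xWord g n b)) := by
    rcases hn.lt_or_eq with hn | hn
    · exact exists_completion_of_two_le hn ⟨hfun, hinj⟩ hray
    · exact exists_completion_of_eq_one hn.symm (by omega) ⟨hfun, hinj⟩ hray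
  refine ⟨W, hW, ι, P, hP, fun w w' => ?_, fun b e h1 he w => (hfull b).pow_apply_ne h1 he w,
    fun word v₀ u h hu => ?_⟩
  · obtain ⟨k, -, hk⟩ := (hfull ⟨0, hn⟩ w w').exists_pow_eq'
    exact ⟨(List.replicate k (xWord g n ⟨0, hn⟩)).flatten, by rw [permEval_flatten_replicate, hk]⟩
  · have himage : wordRel (fun ℓ x y => P ℓ x = y) word (ι v₀) (ι u) :=
      wordRel_map (R' := fun ℓ x y => P ℓ x = y) hP word h
    rw [permEval_eq_of_wordRel (fun _ _ _ _ h => h) himage]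
    exact fun h => hu (ι.injective h)
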